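/- In the abelian group G = ℤ/3 × ℤ/3 × ℤ/5 × ℤ/5 (of order 225), the four 8-element subsets B₁ = {(0,0,0,0),(0,0,0,1),(0,1,0,3),(1,0,0,3),(1,2,1,0),(1,2,4,1),(2,1,1,2),(2,1,4,4)}, B₂ = {(0,0,0,0),(0,0,0,2),(0,1,2,1),(0,1,3,1),(0,2,2,2),(0,2,3,0),(2,1,0,1),(2,2,0,1)}, B₃ = {(0,0,0,0),(0,0,1,1),(1,0,0,1),(1,0,1,0),(1,2,3,3),(2,0,2,3),(2,0,4,3),(2,2,3,3)}, B₄ = {(0,0,0,0),(0,0,1,2),(1,0,3,1),(1,1,2,0),(1,1,4,2),(2,1,3,1),(2,2,2,3),(2,2,4,4)} form a (225,8,1)-difference family: every nonzero element g of G has exactly one representation g = x − y with x, y belonging to the same block Bᵢ. -/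

import Mathlib

def B3 : Fin 4 → Finset (ZMod 3 × ZMod 3 × ZMod 5 × ZMod 5) :=
  ![({(0, 0, 0, 0), (0, 0, 0, 1), (0, 1, 0, 3), (1, 0, 0, 3), (1, 2, 1, 0), (1, 2, 4, 1), (2, 1, 1, 2), (2, 1, 4, 4)} : Finset (ZMod 3 × ZMod 3 × ZMod 5 × ZMod 5)),
    ({(0, 0, 0, 0), (0, 0, 0, 2), (0, 1, 2, 1), (0, 1, 3, 1), (0, 2, 2, 2), (0, 2, 3, 0), (2, 1, 0, 1), (2, 2, 0, 1)} : Finset (ZMod 3 × ZMod 3 × ZMod 5 × ZMod 5)),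
    ({(0, 0, 0, 0), (0, 0, 1, 1), (1, 0, 0, 1), (1, 0, 1, 0), (1, 2, 3, 3), (2, 0, 2, 3), (2, 0, 4, 3), (2, 2, 3, 3)} : Finset (ZMod 3 × ZMod 3 × ZMod 5 × ZMod 5)),
    ({(0, 0, 0, 0), (0, 0, 1, 2), (1, 0, 3, 1), (1, 1, 2, 0), (1, 1, 4, 2), (2, 1, 3, 1), (2, 2, 2, 3), (2, 2, 4, 4)} : Finset (ZMod 3 × ZMod 3 × ZMod 5 × ZMod 5))]

theorem card_B3 : ∀ i : Fin 4, (B3 i).card = 8 := by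
  decide +kernel

theorem exists_sub_eq_of_ne_zero :
    ∀ g : ZMod 3 × ZMod 3 × ZMod 5 × ZMod 5, g ≠ 0 →
      ∃ i, ∃ x ∈ B3 i, ∃ y ∈ B3 i, x - y = g := by
  decide +kernel

/-- If the blocks have as many ordered pairs of distinct elements as the group has nonzero
elements, and every nonzero element is a difference, then it is a difference in one way only. -/
theorem existsUnique_sub_eq_of_card {ι G : Type*} [Fintype ι] [AddCommGroup G] [Fintype G]
    [DecidableEq G] (B : ι → Finset G)
    (hcard : ∑ i, (B i).offDiag.card ≤ Fintype.card G - 1)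
    (hsurj : ∀ g : G, g ≠ 0 → ∃ i, ∃ x ∈ B i, ∃ y ∈ B i, x - y = g) (g : G) (hg : g ≠ 0) :
    ∃! t : ι × G × G, t.2.1 ∈ B t.1 ∧ t.2.2 ∈ B t.1 ∧ t.2.1 - t.2.2 = g := by
  let S : Finset (Σ _ : ι, G × G) := Finset.univ.sigma fun i => (B i).offDiag
  let f : (Σ _ : ι, G × G) → G := fun t => t.2.1 - t.2.2
  have himage : Finset.univ.erase (0 : G) ⊆ S.image f := by
    intro a ha
    obtain ⟨i, x, hx, y, hy, rfl⟩ := hsurj a (Finset.ne_of_mem_erase ha)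
    have hxy : x ≠ y := sub_ne_zero.mp (Finset.ne_of_mem_erase ha)
    exact Finset.mem_image.mpr ⟨⟨i, x, y⟩, by simp [S, hx, hy, hxy], rfl⟩
  have hinj : Set.InjOn f S := by
    apply Finset.card_image_iff.mp
    apply le_antisymm Finset.card_image_le
    calc S.card = ∑ i, (B i).offDiag.card := Finset.card_sigma _ _
      _ ≤ (Finset.univ.erase (0 : G)).card := by simpa using hcard
      _ ≤ (S.image f).card := Finset.card_le_card himage
  have hmem : ∀ i x y, x ∈ B i → y ∈ B i → x - y = g → (⟨i, x, y⟩ : Σ _ : ι, G × G) ∈ S := by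
    intro i x y hx hy hxy
    have hne : x ≠ y := sub_ne_zero.mp (hxy ▸ hg)
    simp [S, hx, hy, hne]
  obtain ⟨i, x, hx, y, hy, hxy⟩ := hsurj g hg
  refine ⟨(i, x, y), ⟨hx, hy, hxy⟩, ?_⟩
  rintro ⟨j, u, v⟩ ⟨hu, hv, huv⟩
  have heq := hinj (hmem j u v hu hv huv) (hmem i x y hx hy hxy) (huv.trans hxy.symm)
  cases heq
  rfl

theorem stmt_3 :
    (∀ i : Fin 4, (B3 i).card = 8) ∧
    ∀ g : ZMod 3 × ZMod 3 × ZMod 5 × ZMod 5, g ≠ 0 →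
      ∃! t : Fin 4 × (ZMod 3 × ZMod 3 × ZMod 5 × ZMod 5) × (ZMod 3 × ZMod 3 × ZMod 5 × ZMod 5),
        t.2.1 ∈ B3 t.1 ∧ t.2.2 ∈ B3 t.1 ∧ t.2.1 - t.2.2 = g := by
  refine ⟨card_B3, existsUnique_sub_eq_of_card B3 ?_ exists_sub_eq_of_ne_zero⟩
  simp [Finset.offDiag_card, card_B3]
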